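/- arXiv:2010.00428 — 7 statements merged into one kernel-verified Lean document; each statement's English description precedes it below -/
import Mathlib

section
/- Let ε > 0 and let g : [α, β] → ℝ be a function of bounded variation such that g(ξ) = 0 for some ξ ∈ [α, β]. Then there exists a Lipschitz continuous function φ : [α, β] → [−1, 1], with Lipschitz constant at most ε^{−2/3}, such that φ(x)·g(x) ≥ 0 for every x ∈ [α, β] and ∫_α^β |g(x)| dx ≤ ∫_α^β φ(x) g(x) dx + 2 ε^{2/3} · Tot.Var.{g; [α, β]}. -/
open Set MeasureTheory intervalIntegral

/-- Total variation of a real-valued function on a set. -/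
noncomputable def totVar (g : ℝ → ℝ) (s : Set ℝ) : ℝ := (eVariationOn g s).toReal

/-- If two sets `A`, `B` cover an order-connected set `I` of reals, then the signed distance
`infDist · A - infDist · B` is `1`-Lipschitz on `I`. -/
theorem infDist_sub_infDist_le_add_abs {I A B : Set ℝ} (hI : I.OrdConnected)
    (hAB : I ⊆ A ∪ B) {x y : ℝ} (hx : x ∈ I) (hy : y ∈ I) :
    Metric.infDist x A - Metric.infDist x B ≤
      Metric.infDist y A - Metric.infDist y B + |x - y| := by
  have hA0 : 0 ≤ Metric.infDist y A := Metric.infDist_nonneg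
  have hB0 : 0 ≤ Metric.infDist x B := Metric.infDist_nonneg
  have hA : Metric.infDist x A ≤ Metric.infDist y A + |x - y| :=
    Metric.infDist_le_infDist_add_dist
  have hB : Metric.infDist y B ≤ Metric.infDist x B + |x - y| := by
    rw [abs_sub_comm]
    exact Metric.infDist_le_infDist_add_dist
  rcases hAB hx with hxA | hxB
  · rw [Metric.infDist_zero_of_mem hxA]
    linarith
  rcases hAB hy with hyA | hyB
  · rw [Metric.infDist_zero_of_mem hxB, Metric.infDist_zero_of_mem hyA] at *
    by_contra! h
    obtain ⟨z, hzI, hzx, hzy⟩ : ∃ z ∈ I, |x - z| < Metric.infDist x A ∧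
        |y - z| < Metric.infDist y B := by
      rcases le_total x y with hxy | hxy
      · rw [abs_of_nonpos (by linarith)] at hA hB h
        refine ⟨(x + y + Metric.infDist x A - Metric.infDist y B) / 2,
          hI.out hx hy ⟨by linarith, by linarith⟩, ?_, ?_⟩ <;>
        rw [abs_lt] <;> constructor <;> linarith
      · rw [abs_of_nonneg (by linarith)] at hA hB h
        refine ⟨(x + y - Metric.infDist x A + Metric.infDist y B) / 2,
          hI.out hy hx ⟨by linarith, by linarith⟩, ?_, ?_⟩ <;>
        rw [abs_lt] <;> constructor <;> linarith
    rcases hAB hzI with hz | hz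
    · exact absurd (Metric.infDist_le_dist_of_mem hz) (not_le.2 hzx)
    · exact absurd (Metric.infDist_le_dist_of_mem hz) (not_le.2 hzy)
  · rw [Metric.infDist_zero_of_mem hyB]
    linarith

/-- The integral over `[a, b]` of the symmetric difference `V (x + h) - V (x - h)` of a monotone
function with values in `[m, M]` is at most `2 h (M - m)`. -/
theorem Monotone.integral_symm_diff_le {V : ℝ → ℝ} (hV : Monotone V) {a b h m M : ℝ}
    (hh : 0 ≤ h) (hm : ∀ x, m ≤ V x) (hM : ∀ x, V x ≤ M) :
    ∫ x in a..b, (V (x + h) - V (x - h)) ≤ 2 * h * (M - m) := by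
  have hint : ∀ c d, IntervalIntegrable V volume c d := fun c d => hV.intervalIntegrable
  have hadd : IntervalIntegrable (fun x => V (x + h)) volume a b :=
    Monotone.intervalIntegrable fun x y hxy => hV (by linarith)
  have hsub : IntervalIntegrable (fun x => V (x - h)) volume a b :=
    Monotone.intervalIntegrable fun x y hxy => hV (by linarith)
  rw [intervalIntegral.integral_sub hadd hsub, intervalIntegral.integral_comp_add_right,
    intervalIntegral.integral_comp_sub_right,
    intervalIntegral.integral_interval_sub_interval_comm' (hint _ _) (hint _ _) (hint _ _)]
  have hup : ∫ x in (b - h)..(b + h), V x ≤ ∫ _x in (b - h)..(b + h), M :=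
    intervalIntegral.integral_mono_on (by linarith) (hint _ _) intervalIntegrable_const
      fun x _ => hM x
  have hlow : ∫ _x in (a - h)..(a + h), m ≤ ∫ x in (a - h)..(a + h), V x :=
    intervalIntegral.integral_mono_on (by linarith) intervalIntegrable_const (hint _ _)
      fun x _ => hm x
  rw [intervalIntegral.integral_const, smul_eq_mul] at hup hlow
  linarith

theorem BoundedVariationOn.intervalIntegrable {g : ℝ → ℝ} {a b : ℝ}
    (hg : BoundedVariationOn g (Set.uIcc a b)) : IntervalIntegrable g volume a b := by
  obtain ⟨p, q, hp, hq, rfl⟩ := hg.locallyBoundedVariationOn.exists_monotoneOn_sub_monotoneOn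
  exact hp.intervalIntegrable.sub hq.intervalIntegrable

/-- The signed distance to the complements of the positivity and negativity sets of `g` in `I`,
rescaled by `h` and truncated to `[-1, 1]`: a continuous substitute for the sign of `g`. -/
noncomputable def lipschitzSign (g : ℝ → ℝ) (I : Set ℝ) (h x : ℝ) : ℝ :=
  max (-1) (min 1 (h⁻¹ * (Metric.infDist x {y ∈ I | g y ≤ 0} -
    Metric.infDist x {y ∈ I | 0 ≤ g y})))

section lipschitzSign

variable {g : ℝ → ℝ} {I : Set ℝ} {h x : ℝ}

theorem lipschitzSign_mem_Icc : lipschitzSign g I h x ∈ Set.Icc (-1 : ℝ) 1 :=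
  ⟨le_max_left _ _, max_le (by norm_num) (min_le_left _ _)⟩

theorem lipschitzOnWith_lipschitzSign (hI : I.OrdConnected) (hh : 0 ≤ h) :
    LipschitzOnWith (Real.toNNReal h⁻¹) (lipschitzSign g I h) I := by
  refine LipschitzOnWith.of_le_add_mul _ fun x hx y hy => ?_
  have hh' : 0 ≤ h⁻¹ := inv_nonneg.2 hh
  rw [Real.coe_toNNReal _ hh', Real.dist_eq]
  have hcover : I ⊆ {y ∈ I | g y ≤ 0} ∪ {y ∈ I | 0 ≤ g y} := fun z hz =>
    (le_total (g z) 0).imp (⟨hz, ·⟩) (⟨hz, ·⟩)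
  have key := mul_le_mul_of_nonneg_left (infDist_sub_infDist_le_add_abs hI hcover hx hy) hh'
  rw [mul_add] at key
  have hnonneg : 0 ≤ h⁻¹ * |x - y| := by positivity
  unfold lipschitzSign
  grind

theorem lipschitzSign_of_nonneg (hh : 0 ≤ h) (hx : x ∈ I) (hg : 0 ≤ g x) :
    lipschitzSign g I h x = min 1 (h⁻¹ * Metric.infDist x {y ∈ I | g y ≤ 0}) := by
  have h0 : 0 ≤ h⁻¹ * Metric.infDist x {y ∈ I | g y ≤ 0} :=
    mul_nonneg (inv_nonneg.2 hh) Metric.infDist_nonneg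
  rw [lipschitzSign, Metric.infDist_zero_of_mem (s := {y ∈ I | 0 ≤ g y}) ⟨hx, hg⟩, sub_zero]
  exact max_eq_right (le_trans (by norm_num) (le_min zero_le_one h0))

theorem lipschitzSign_neg : lipschitzSign (-g) I h x = -lipschitzSign g I h x := by
  simp only [lipschitzSign, Pi.neg_apply, Left.neg_nonpos_iff, Left.nonneg_neg_iff]
  grind

theorem lipschitzSign_mul_nonneg (hh : 0 ≤ h) (hx : x ∈ I) :
    0 ≤ lipschitzSign g I h x * g x := by
  wlog hg : 0 ≤ g x generalizing g
  · have := this (g := -g) (by simpa using (not_le.1 hg).le)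
    simpa [lipschitzSign_neg] using this
  · rw [lipschitzSign_of_nonneg hh hx hg]
    exact mul_nonneg (le_min zero_le_one (mul_nonneg (inv_nonneg.2 hh) Metric.infDist_nonneg)) hg

/-- The defect `|g| - φ g` of the Lipschitz sign `φ` at `x` vanishes unless `g` takes a value of
the opposite sign at distance less than `h`. -/
theorem abs_sub_lipschitzSign_mul_le (hh : 0 < h) (hzero : ∃ ξ ∈ I, g ξ = 0) (hx : x ∈ I) :
    |g x| - lipschitzSign g I h x * g x ≤ 0 ∨
      ∃ y ∈ I, |x - y| < h ∧ |g x| - lipschitzSign g I h x * g x ≤ |g x - g y| := by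
  wlog hg : 0 ≤ g x generalizing g
  · have := this (g := -g) (by simpa using hzero) (by simpa using (not_le.1 hg).le)
    simpa [lipschitzSign_neg, neg_add_eq_sub, abs_sub_comm] using this
  · obtain ⟨ξ, hξ, hgξ⟩ := hzero
    have hsign := lipschitzSign_of_nonneg hh.le hx hg
    rw [abs_of_nonneg hg]
    rcases le_or_gt h (Metric.infDist x {y ∈ I | g y ≤ 0}) with hd | hd
    · left
      rw [hsign, min_eq_left ((le_inv_mul_iff₀ hh).2 (by linarith))]
      linarith
    · right
      obtain ⟨y, ⟨hy, hgy⟩, hxy⟩ :=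
        (Metric.infDist_lt_iff (s := {y ∈ I | g y ≤ 0}) ⟨ξ, hξ, hgξ.le⟩).1 hd
      refine ⟨y, hy, hxy, ?_⟩
      have := lipschitzSign_mul_nonneg hh.le hx (g := g)
      linarith [le_abs_self (g x - g y)]

end lipschitzSign

/-- given `ε > 0` and a BV function `g : [α,β] → ℝ` vanishing at some
point of `[α,β]`, there is a Lipschitz test function `φ` with Lipschitz constant at most
`ε^(-2/3)`, taking values in `[-1,1]`, with `φ·g ≥ 0`, and
`∫ |g| ≤ ∫ φ g + 2 ε^(2/3) · Tot.Var.{g; [α,β]}`. -/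
theorem stmt0 (ε α β : ℝ) (hε : 0 < ε) (g : ℝ → ℝ)
    (hBV : BoundedVariationOn g (Set.Icc α β))
    (hzero : ∃ ξ ∈ Set.Icc α β, g ξ = 0) :
    ∃ φ : ℝ → ℝ,
      LipschitzOnWith (Real.toNNReal (ε ^ (-(2:ℝ)/3))) φ (Set.Icc α β) ∧
      (∀ x ∈ Set.Icc α β, φ x ∈ Set.Icc (-1 : ℝ) 1) ∧
      (∀ x ∈ Set.Icc α β, 0 ≤ φ x * g x) ∧
      ∫ x in α..β, |g x| ≤ (∫ x in α..β, φ x * g x) +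
        2 * ε ^ ((2:ℝ)/3) * totVar g (Set.Icc α β) := by
  obtain ⟨ξ, hξ, hgξ⟩ := hzero
  have hαβ : α ≤ β := hξ.1.trans hξ.2
  set I := Set.Icc α β
  set h := ε ^ ((2 : ℝ) / 3)
  have hh : 0 < h := Real.rpow_pos_of_pos hε _
  have hinv : ε ^ (-(2 : ℝ) / 3) = h⁻¹ := by rw [neg_div, Real.rpow_neg hε.le]
  have hlip := lipschitzOnWith_lipschitzSign (g := g) (Set.ordConnected_Icc (a := α) (b := β)) hh.le
  refine ⟨lipschitzSign g I h, hinv ▸ hlip, fun _ _ => lipschitzSign_mem_Icc,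
    fun x hx => lipschitzSign_mul_nonneg hh.le hx, ?_⟩
  have hloc := hBV.locallyBoundedVariationOn
  have hαI : α ∈ I := ⟨le_rfl, hαβ⟩
  have hβI : β ∈ I := ⟨hαβ, le_rfl⟩
  let W := variationOnFromTo g I α
  have hWmono : MonotoneOn W I := variationOnFromTo.monotoneOn hloc hαI
  let V : ℝ → ℝ := fun x => W (Set.projIcc α β hαβ x)
  have hV : Monotone V := fun x y hxy =>
    hWmono (Subtype.prop _) (Subtype.prop _) (Set.monotone_projIcc hαβ hxy)
  have hVW : ∀ x ∈ I, V x = W x := fun x hx => by simp only [V, Set.projIcc_of_mem hαβ hx]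
  have hV0 : ∀ x, 0 ≤ V x := fun x =>
    variationOnFromTo.nonneg_of_le g I (Set.projIcc α β hαβ x).2.1
  have hV1 : ∀ x, V x ≤ totVar g I := fun x =>
    (le_abs_self _).trans (variationOnFromTo.abs_le_eVariationOn hBV)
  have hdiff : ∀ x ∈ I, ∀ y ∈ I, |x - y| < h → |g x - g y| ≤ V (x + h) - V (x - h) := by
    intro x hx y hy hxy
    have hxy' := abs_lt.1 hxy
    rcases le_total x y with hle | hle
    · have := variationOnFromTo.abs_sub_le_sub_of_le hloc hαI hx hy hle
      rw [abs_sub_comm]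
      linarith [hVW x hx, hVW y hy, hV (show y ≤ x + h by linarith),
        hV (show x - h ≤ x by linarith)]
    · have := variationOnFromTo.abs_sub_le_sub_of_le hloc hαI hy hx hle
      linarith [hVW x hx, hVW y hy, hV (show x ≤ x + h by linarith),
        hV (show x - h ≤ y by linarith)]
  have hpt : ∀ x ∈ I, |g x| - lipschitzSign g I h x * g x ≤ V (x + h) - V (x - h) := by
    intro x hx
    rcases abs_sub_lipschitzSign_mul_le hh ⟨ξ, hξ, hgξ⟩ hx with hle | ⟨y, hy, hxy, hle⟩
    · linarith [hV (show x - h ≤ x + h by linarith)]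
    · exact hle.trans (hdiff x hx y hy hxy)
  have hgint : IntervalIntegrable g volume α β :=
    BoundedVariationOn.intervalIntegrable (by rwa [Set.uIcc_of_le hαβ])
  have hφint : IntervalIntegrable (fun x => lipschitzSign g I h x * g x) volume α β :=
    hgint.continuousOn_mul (by rw [Set.uIcc_of_le hαβ]; exact hlip.continuousOn)
  have hVint : IntervalIntegrable (fun x => V (x + h) - V (x - h)) volume α β :=
    (Monotone.intervalIntegrable fun x y hxy => hV (by linarith)).sub
      (Monotone.intervalIntegrable fun x y hxy => hV (by linarith))
  have hmono := intervalIntegral.integral_mono_on hαβ (hgint.abs.sub hφint) hVint hpt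
  rw [intervalIntegral.integral_sub hgint.abs hφint] at hmono
  linarith [hV.integral_symm_diff_le (a := α) (b := β) hh.le hV0 hV1]
end

section
/- Let ε > 0, let w : [0, ε] → ℝ be a function of bounded variation, and let φ : [0, ε] → ℝ be continuously differentiable. Let w̄ = ε^{−1} ∫_0^ε w(y) dy denote the average value of w. Then | ∫_0^ε ( w(x) − w̄ ) φ(x) dx | ≤ Tot.Var.{w; (0, ε)} · ε² · ‖φ'‖_{L∞}. -/
open Set MeasureTheory intervalIntegral

/-- A bound on the open interval suffices to bound an interval integral. -/
theorem abs_intervalIntegral_le_of_forall_mem_Ioo {a b C : ℝ} (hab : a ≤ b) {f : ℝ → ℝ}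
    (hf : ∀ x ∈ Set.Ioo a b, |f x| ≤ C) : |∫ x in a..b, f x| ≤ C * (b - a) := by
  rw [intervalIntegral.integral_of_le hab, integral_Ioc_eq_integral_Ioo]
  have h := norm_setIntegral_le_of_norm_le_const (μ := volume) (s := Set.Ioo a b)
    (f := f) (C := C) (by simp) hf
  simpa [Measure.real, hab] using h

/-- A function of bounded variation on a bounded open interval is integrable there. -/
theorem BoundedVariationOn.intervalIntegrable_of_Ioo {a b : ℝ} (hab : a < b) {w : ℝ → ℝ}
    (hw : BoundedVariationOn w (Set.Ioo a b)) : IntervalIntegrable w volume a b := by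
  rw [intervalIntegrable_iff_integrableOn_Ioo_of_le hab.le]
  obtain ⟨p, q, hp, hq, rfl⟩ :=
    hw.locallyBoundedVariationOn.exists_monotoneOn_sub_monotoneOn
  have hmeas : AEMeasurable (p - q) (volume.restrict (Set.Ioo a b)) :=
    (aemeasurable_restrict_of_monotoneOn measurableSet_Ioo hp).sub
      (aemeasurable_restrict_of_monotoneOn measurableSet_Ioo hq)
  obtain ⟨c, hc⟩ := Set.nonempty_Ioo.2 hab
  refine IntegrableOn.of_bound (by simp) hmeas.aestronglyMeasurable
    (|(p - q) c| + (eVariationOn (p - q) (Set.Ioo a b)).toReal) ?_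
  refine (ae_restrict_iff' measurableSet_Ioo).2 (Filter.Eventually.of_forall fun x hx => ?_)
  have h := hw.dist_le hx hc
  rw [Real.dist_eq] at h
  rw [Real.norm_eq_abs]
  linarith [abs_sub_abs_le_abs_sub ((p - q) x) ((p - q) c)]

/-- A function of bounded variation differs from its average by at most its total variation. -/
theorem BoundedVariationOn.abs_sub_average_le {ε : ℝ} (hε : 0 < ε) {w : ℝ → ℝ}
    (hw : BoundedVariationOn w (Set.Ioo 0 ε)) {x : ℝ} (hx : x ∈ Set.Ioo 0 ε) :
    |w x - (∫ y in (0:ℝ)..ε, w y) / ε| ≤ (eVariationOn w (Set.Ioo 0 ε)).toReal := by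
  have hint := hw.intervalIntegrable_of_Ioo hε
  have h : |∫ y in (0:ℝ)..ε, (w x - w y)| ≤
      (eVariationOn w (Set.Ioo 0 ε)).toReal * (ε - 0) :=
    abs_intervalIntegral_le_of_forall_mem_Ioo hε.le fun y hy => by
      simpa [Real.dist_eq] using hw.dist_le hx hy
  rw [intervalIntegral.integral_sub intervalIntegrable_const hint,
    intervalIntegral.integral_const, smul_eq_mul, sub_zero] at h
  have e : w x - (∫ y in (0:ℝ)..ε, w y) / ε = (ε * w x - ∫ y in (0:ℝ)..ε, w y) / ε := by
    field_simp
  rwa [e, abs_div, abs_of_pos hε, div_le_iff₀ hε]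

/-- Lemma 6.1: if `w : [0,ε] → ℝ` has bounded variation, `φ` is `C¹`
on `[0,ε]` and `w̄` is the average of `w`, then
`|∫₀^ε (w − w̄) φ| ≤ Tot.Var.{w; (0,ε)} · ε² · ‖φ'‖_{L∞}`. -/
theorem stmt7 (ε : ℝ) (hε : 0 < ε) (w : ℝ → ℝ) (φ : ℝ → ℝ)
    (hw : BoundedVariationOn w (Set.Ioo 0 ε))
    (hφ : ContDiffOn ℝ 1 φ (Set.Icc 0 ε))
    (N : ℝ) (hN : ∀ x ∈ Set.Icc (0:ℝ) ε, |derivWithin φ (Set.Icc 0 ε) x| ≤ N) :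
    |∫ x in (0:ℝ)..ε, (w x - (∫ y in (0:ℝ)..ε, w y) / ε) * φ x| ≤
      (eVariationOn w (Set.Ioo 0 ε)).toReal * ε ^ 2 * N := by
  have hint := hw.intervalIntegrable_of_Ioo hε
  have hN0 : 0 ≤ N := (abs_nonneg _).trans (hN 0 (Set.left_mem_Icc.2 hε.le))
  have hdiff : ∀ x ∈ Set.Ioo 0 ε, |φ x - φ 0| ≤ N * ε := fun x hx => by
    have h := (convex_Icc 0 ε).norm_image_sub_le_of_norm_derivWithin_le
      (hφ.differentiableOn one_ne_zero) hN (Set.left_mem_Icc.2 hε.le) (Set.Ioo_subset_Icc_self hx)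
    rw [Real.norm_eq_abs, Real.norm_eq_abs, sub_zero, abs_of_pos hx.1] at h
    exact h.trans (mul_le_mul_of_nonneg_left hx.2.le hN0)
  have hbound := abs_intervalIntegral_le_of_forall_mem_Ioo hε.le
    (f := fun x => (w x - (∫ y in (0:ℝ)..ε, w y) / ε) * (φ x - φ 0))
    (C := (eVariationOn w (Set.Ioo 0 ε)).toReal * (N * ε)) fun x hx => by
      rw [abs_mul]
      exact mul_le_mul (hw.abs_sub_average_le hε hx) (hdiff x hx) (abs_nonneg _)
        ENNReal.toReal_nonneg
  have hsub : IntervalIntegrable (fun x => w x - (∫ y in (0:ℝ)..ε, w y) / ε) volume 0 ε :=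
    hint.sub intervalIntegrable_const
  have hzero : ∫ x in (0:ℝ)..ε, (w x - (∫ y in (0:ℝ)..ε, w y) / ε) = 0 := by
    rw [intervalIntegral.integral_sub hint intervalIntegrable_const,
      intervalIntegral.integral_const, smul_eq_mul, sub_zero, mul_div_cancel₀ _ hε.ne', sub_self]
  have hmul : IntervalIntegrable (fun x => (w x - (∫ y in (0:ℝ)..ε, w y) / ε) * φ x)
      volume 0 ε :=
    hsub.mul_continuousOn (by rw [Set.uIcc_of_le hε.le]; exact hφ.continuousOn)
  have heq : ∫ x in (0:ℝ)..ε, (w x - (∫ y in (0:ℝ)..ε, w y) / ε) * (φ x - φ 0) =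
      ∫ x in (0:ℝ)..ε, (w x - (∫ y in (0:ℝ)..ε, w y) / ε) * φ x := by
    simp_rw [mul_sub _ (φ _) (φ 0)]
    rw [intervalIntegral.integral_sub hmul (hsub.mul_const _),
      intervalIntegral.integral_mul_const, hzero, zero_mul, sub_zero]
  rw [heq] at hbound
  exact hbound.trans_eq (by ring)
end

section
/- Let ε > 0 and let u : ℝ → ℝⁿ be integrable and of bounded variation. Let P_ε u denote the cell-average projection of u on the grid of mesh ε. Then for every continuously differentiable compactly supported φ : ℝ → ℝ, | ∫_ℝ ( u(x) − P_ε u(x) ) φ(x) dx | ≤ ε² ‖φ'‖_{L∞} · Tot.Var.{u}. -/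
open Set MeasureTheory intervalIntegral

/-- The cell-average projection on the grid of mesh `ε`:
`P_ε u (x) = ε⁻¹ ∫_{jε}^{(j+1)ε} u(y) dy` for `x ∈ [jε, (j+1)ε)`. -/
noncomputable def cellAvg {n : ℕ} (ε : ℝ) (u : ℝ → EuclideanSpace ℝ (Fin n)) (x : ℝ) :
    EuclideanSpace ℝ (Fin n) :=
  ε⁻¹ • ∫ y in ((⌊x / ε⌋ : ℝ) * ε)..(((⌊x / ε⌋ : ℝ) + 1) * ε), u y

/-- On a grid cell the projection is the cell average. -/
theorem cellAvg_eq_of_mem_Ico {n : ℕ} {ε : ℝ} (hε : 0 < ε) (u : ℝ → EuclideanSpace ℝ (Fin n))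
    (j : ℤ) {x : ℝ} (hx : x ∈ Ico ((j : ℝ) * ε) (((j : ℝ) + 1) * ε)) :
    cellAvg ε u x = ε⁻¹ • ∫ y in ((j : ℝ) * ε)..(((j : ℝ) + 1) * ε), u y := by
  have hj : ⌊x / ε⌋ = j :=
    Int.floor_eq_iff.2 ⟨(le_div_iff₀ hε).2 hx.1, (div_lt_iff₀ hε).2 hx.2⟩
  rw [cellAvg, hj]

/-- The distance from a value of `u` on `[a, b]` to the mean of `u` over `[a, b]` is at most the
variation of `u` on `[a, b]`. -/
theorem norm_sub_average_le_variation {E : Type*} [NormedAddCommGroup E] [NormedSpace ℝ E]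
    [CompleteSpace E] {u : ℝ → E} {a b : ℝ} (hab : a < b) (hu : IntervalIntegrable u volume a b)
    (hBV : BoundedVariationOn u (Icc a b)) {x : ℝ} (hx : x ∈ Icc a b) :
    ‖u x - (b - a)⁻¹ • ∫ y in a..b, u y‖ ≤ (eVariationOn u (Icc a b)).toReal := by
  have hpos : 0 < b - a := sub_pos.2 hab
  have h : u x - (b - a)⁻¹ • ∫ y in a..b, u y = (b - a)⁻¹ • ∫ y in a..b, (u x - u y) := by
    rw [intervalIntegral.integral_sub intervalIntegrable_const hu,
      intervalIntegral.integral_const, smul_sub, inv_smul_smul₀ hpos.ne']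
  have hle : ‖∫ y in a..b, (u x - u y)‖ ≤ (eVariationOn u (Icc a b)).toReal * |b - a| := by
    refine intervalIntegral.norm_integral_le_of_norm_le_const fun y hy => ?_
    rw [uIoc_of_le hab.le] at hy
    rw [← dist_eq_norm]
    exact hBV.dist_le hx (Ioc_subset_Icc_self hy)
  rw [h, norm_smul, norm_inv, Real.norm_of_nonneg hpos.le, inv_mul_le_iff₀ hpos, mul_comm]
  rwa [abs_of_pos hpos] at hle

/-- Subtracting the mean of `u` over `[a, b]` makes the integral against a Lipschitz function
quadratically small in the length of the interval. -/
theorem norm_integral_smul_sub_average_le {E : Type*} [NormedAddCommGroup E] [NormedSpace ℝ E]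
    [CompleteSpace E] {u : ℝ → E} {a b : ℝ} (hab : a < b) (hu : IntervalIntegrable u volume a b)
    (hBV : BoundedVariationOn u (Icc a b)) {φ : ℝ → ℝ} (hφ : Continuous φ) {N : ℝ}
    (hN : ∀ x y, |φ x - φ y| ≤ N * |x - y|) :
    ‖∫ x in a..b, φ x • (u x - (b - a)⁻¹ • ∫ y in a..b, u y)‖ ≤
      (b - a) ^ 2 * N * (eVariationOn u (Icc a b)).toReal := by
  have hpos : 0 < b - a := sub_pos.2 hab
  set m := (b - a)⁻¹ • ∫ y in a..b, u y with hm
  have hum : IntervalIntegrable (fun x => u x - m) volume a b := hu.sub intervalIntegrable_const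
  have hmean : ∫ x in a..b, (u x - m) = 0 := by
    rw [intervalIntegral.integral_sub hu intervalIntegrable_const,
      intervalIntegral.integral_const, hm, smul_inv_smul₀ hpos.ne', sub_self]
  have h : ∫ x in a..b, φ x • (u x - m) = ∫ x in a..b, (φ x - φ a) • (u x - m) := by
    simp_rw [sub_smul (φ _)]
    rw [intervalIntegral.integral_sub (hum.continuousOn_smul hφ.continuousOn)
      (hum.continuousOn_smul continuousOn_const), intervalIntegral.integral_smul, hmean, smul_zero, sub_zero]
  have hN0 : 0 ≤ N := by
    have := (abs_nonneg _).trans (hN 1 0)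
    norm_num at this
    exact this
  have hle : ‖∫ x in a..b, (φ x - φ a) • (u x - m)‖ ≤
      (N * (b - a) * (eVariationOn u (Icc a b)).toReal) * |b - a| := by
    refine intervalIntegral.norm_integral_le_of_norm_le_const fun x hx => ?_
    rw [uIoc_of_le hab.le] at hx
    rw [norm_smul, Real.norm_eq_abs]
    have hxa : |φ x - φ a| ≤ N * (b - a) := by
      refine (hN x a).trans (mul_le_mul_of_nonneg_left ?_ hN0)
      rw [abs_of_pos (sub_pos.2 hx.1)]
      linarith [hx.2]
    exact mul_le_mul hxa (norm_sub_average_le_variation hab hu hBV (Ioc_subset_Icc_self hx))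
      (norm_nonneg _) (by positivity)
  rw [h]
  refine hle.trans_eq ?_
  rw [abs_of_pos hpos]
  ring

/-- The variations on consecutive intervals add up to the variation on their union. -/
theorem sum_variationOnFromTo_adjacent {E : Type*} [PseudoEMetricSpace E] {u : ℝ → E}
    (hBV : LocallyBoundedVariationOn u univ) (a : ℕ → ℝ) (k : ℕ) :
    ∑ i ∈ Finset.range k, variationOnFromTo u univ (a i) (a (i + 1)) =
      variationOnFromTo u univ (a 0) (a k) := by
  induction k with
  | zero => simp [variationOnFromTo.self]
  | succ k ih =>
    rw [Finset.sum_range_succ, ih]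
    exact variationOnFromTo.add hBV (mem_univ _) (mem_univ _) (mem_univ _)

/-- for `u` integrable with bounded variation and `φ` a `C¹` compactly
supported test function, `|∫ (u − P_ε u) φ| ≤ ε² ‖φ'‖_{L∞} · Tot.Var.{u}`. -/
theorem stmt8 {n : ℕ} (ε : ℝ) (hε : 0 < ε) (u : ℝ → EuclideanSpace ℝ (Fin n))
    (hu : Integrable u) (hBV : BoundedVariationOn u Set.univ)
    (φ : ℝ → ℝ) (hφ : ContDiff ℝ 1 φ) (hsupp : HasCompactSupport φ)
    (N : ℝ) (hN : ∀ x, |deriv φ x| ≤ N) :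
    ‖∫ x, φ x • (u x - cellAvg ε u x)‖ ≤
      ε ^ 2 * N * (eVariationOn u Set.univ).toReal := by
  have hlip : ∀ x y, |φ x - φ y| ≤ N * |x - y| := fun x y =>
    Convex.norm_image_sub_le_of_norm_deriv_le (f := φ) (s := univ)
      (fun z _ => (hφ.differentiable one_ne_zero) z) (fun z _ => hN z)
      convex_univ (mem_univ y) (mem_univ x)
  have hN0 : 0 ≤ N := (abs_nonneg _).trans (hN 0)
  obtain ⟨R, hR⟩ := hsupp.isCompact.isBounded.subset_ball 0
  obtain ⟨K, hK⟩ := exists_nat_gt (R / ε)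
  have hRK : R < K * ε := (div_lt_iff₀ hε).1 hK
  set j : ℕ → ℤ := fun i => (i : ℤ) - K with hj
  set a : ℕ → ℝ := fun i => (j i : ℝ) * ε with ha
  have hsucc : ∀ i, a (i + 1) = ((j i : ℝ) + 1) * ε := fun i => by
    simp only [ha, hj]; push_cast; ring
  have hlen : ∀ i, a (i + 1) - a i = ε := fun i => by rw [hsucc]; simp only [ha]; ring
  have hlt : ∀ i, a i < a (i + 1) := fun i => by linarith [hlen i]
  have hmono : Monotone a := monotone_nat_of_le_succ fun i => (hlt i).le
  have ha0 : a 0 = -(K * ε) := by simp [ha, hj]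
  have haK : a (2 * K) = K * ε := by simp only [ha, hj]; push_cast; ring
  set F : ℝ → EuclideanSpace ℝ (Fin n) := fun x => φ x • (u x - cellAvg ε u x) with hF
  set G : ℕ → ℝ → EuclideanSpace ℝ (Fin n) := fun i x =>
    φ x • (u x - (a (i + 1) - a i)⁻¹ • ∫ y in a i..a (i + 1), u y) with hG
  have hGF : ∀ i, EqOn (G i) F (Ioo (a i) (a (i + 1))) := fun i x hx => by
    have hx' : x ∈ Ico ((j i : ℝ) * ε) (((j i : ℝ) + 1) * ε) :=
      ⟨hx.1.le, (hsucc i) ▸ hx.2⟩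
    simp only [hF, hG]
    rw [cellAvg_eq_of_mem_Ico hε u (j i) hx', hlen, hsucc]
  have hGae : ∀ i, G i =ᵐ[volume.restrict (uIoc (a i) (a (i + 1)))] F := fun i => by
    rw [uIoc_of_le (hlt i).le, ← restrict_Ioo_eq_restrict_Ioc]
    exact (ae_restrict_iff' measurableSet_Ioo).2 (ae_of_all _ (hGF i))
  have hGint : ∀ i, IntervalIntegrable (G i) volume (a i) (a (i + 1)) := fun i =>
    (hu.intervalIntegrable.sub intervalIntegrable_const).continuousOn_smul
      hφ.continuous.continuousOn
  have hFint : ∀ i, IntervalIntegrable F volume (a i) (a (i + 1)) := fun i =>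
    (hGint i).congr_ae (hGae i)
  have hcell : ∀ i, ‖∫ x in a i..a (i + 1), F x‖ ≤
      ε ^ 2 * N * variationOnFromTo u univ (a i) (a (i + 1)) := fun i => by
    rw [← intervalIntegral.integral_congr_ae_restrict (hGae i),
      variationOnFromTo.eq_of_le _ _ (hlt i).le, univ_inter]
    have h := norm_integral_smul_sub_average_le (hlt i) hu.intervalIntegrable
      (hBV.mono (subset_univ _)) hφ.continuous hlip
    rwa [congrArg (· ^ 2) (hlen i)] at h
  have hzero : ∀ x, x ∉ Ioc (a 0) (a (2 * K)) → F x = 0 := fun x hx => by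
    have : φ x = 0 := by
      by_contra hne
      have hxR := hR (subset_tsupport _ hne)
      rw [mem_ball_zero_iff, Real.norm_eq_abs, abs_lt] at hxR
      exact hx ⟨by linarith, by linarith⟩
    simp [hF, this]
  have hsum : ∫ x, F x = ∑ i ∈ Finset.range (2 * K), ∫ x in a i..a (i + 1), F x := by
    rw [intervalIntegral.sum_integral_adjacent_intervals fun i _ => hFint i,
      intervalIntegral.integral_of_le (hmono (Nat.zero_le _)),
      setIntegral_eq_integral_of_forall_compl_eq_zero hzero]
  calc ‖∫ x, F x‖ ≤ ∑ i ∈ Finset.range (2 * K), ‖∫ x in a i..a (i + 1), F x‖ := by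
        rw [hsum]; exact norm_sum_le _ _
    _ ≤ ∑ i ∈ Finset.range (2 * K), ε ^ 2 * N * variationOnFromTo u univ (a i) (a (i + 1)) :=
        Finset.sum_le_sum fun i _ => hcell i
    _ = ε ^ 2 * N * variationOnFromTo u univ (a 0) (a (2 * K)) := by
        rw [← Finset.mul_sum, sum_variationOnFromTo_adjacent hBV.locallyBoundedVariationOn]
    _ ≤ ε ^ 2 * N * (eVariationOn u univ).toReal := by
        rw [variationOnFromTo.eq_of_le _ _ (hmono (Nat.zero_le _))]
        exact mul_le_mul_of_nonneg_left
          (ENNReal.toReal_mono hBV (eVariationOn.mono u inter_subset_left)) (by positivity)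
end

section
/- Let K be a smoothing kernel and, for δ > 0, let K_δ(x) = δ^{−1} K(x/δ). Then there exists a constant C, depending only on K, such that for every integrable function w : ℝ → ℝ of bounded variation and every Lipschitz continuous compactly supported φ : ℝ → ℝ, | ∫_ℝ ( (K_δ * w)(x) − w(x) ) φ(x) dx | ≤ C δ² · max{‖φ‖_{L∞}, ‖φ'‖_{L∞}} · Tot.Var.{w}. -/
open Set MeasureTheory

/-- Translating a function of bounded variation moves it in `L¹` by at most the size of the
translation times the total variation. -/
lemma integral_abs_translate_sub_le_of_nonneg {w : ℝ → ℝ} (hw : Integrable w)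
    (hbv : BoundedVariationOn w univ) {z : ℝ} (hz : 0 ≤ z) :
    ∫ x, |w (x + z) - w x| ≤ z * (eVariationOn w univ).toReal := by
  have hloc := hbv.locallyBoundedVariationOn
  set V : ℝ → ℝ := variationOnFromTo w univ 0 with hV
  have hVsub : ∀ a b, V b - V a = variationOnFromTo w univ a b := fun a b => by
    have := variationOnFromTo.add hloc (mem_univ 0) (mem_univ a) (mem_univ b)
    simp only [hV]; linarith
  have hmono : Monotone V := monotoneOn_univ.1 (variationOnFromTo.monotoneOn hloc (mem_univ 0))
  have hle : ∀ a b, a ≤ b → V b - V a ≤ (eVariationOn w univ).toReal := fun a b hab => by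
    rw [hVsub, variationOnFromTo.eq_of_le w univ hab]
    exact ENNReal.toReal_mono hbv (eVariationOn.mono w inter_subset_left)
  have hint : ∀ a b, IntervalIntegrable V volume a b := fun a b => hmono.intervalIntegrable
  have hmonoz : Monotone fun x => V (x + z) := fun a b hab => hmono (by linarith)
  have hdiff : Integrable fun x => |w (x + z) - w x| := ((hw.comp_add_right z).sub hw).abs
  have hpt : ∀ x, |w (x + z) - w x| ≤ V (x + z) - V x := fun x => by
    have hx : x ≤ x + z := by linarith
    rw [hVsub, variationOnFromTo.eq_of_le w univ hx, ← Real.dist_eq, dist_edist]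
    exact ENNReal.toReal_mono (hloc x (x + z) (mem_univ _) (mem_univ _))
      (eVariationOn.edist_le w ⟨mem_univ _, hx, le_rfl⟩ ⟨mem_univ _, le_rfl, hx⟩)
  have hbound : ∀ R : ℝ, 0 ≤ R →
      ∫ x in (-R)..R, |w (x + z) - w x| ≤ z * (eVariationOn w univ).toReal := fun R hR => by
    calc ∫ x in (-R)..R, |w (x + z) - w x|
        ≤ ∫ x in (-R)..R, (V (x + z) - V x) :=
          intervalIntegral.integral_mono_on (by linarith) hdiff.intervalIntegrable
            (hmonoz.intervalIntegrable.sub (hint _ _)) fun x _ => hpt x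
      _ = (∫ x in R..(R + z), V x) - ∫ x in (-R)..(-R + z), V x := by
          rw [intervalIntegral.integral_sub hmonoz.intervalIntegrable (hint _ _),
            intervalIntegral.integral_comp_add_right]
          have h1 := intervalIntegral.integral_add_adjacent_intervals
            (hint (-R) (-R + z)) (hint (-R + z) (R + z))
          have h2 := intervalIntegral.integral_add_adjacent_intervals
            (hint (-R) R) (hint R (R + z))
          linarith
      _ ≤ (∫ _ in R..(R + z), V (R + z)) - ∫ _ in (-R)..(-R + z), V (-R) := by
          refine sub_le_sub ?_ ?_
          · exact intervalIntegral.integral_mono_on (by linarith) (hint _ _) (by simp)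
              fun x hx => hmono hx.2
          · exact intervalIntegral.integral_mono_on (by linarith) (by simp) (hint _ _)
              fun x hx => hmono hx.1
      _ = z * (V (R + z) - V (-R)) := by
          simp only [intervalIntegral.integral_const, smul_eq_mul]; ring
      _ ≤ z * (eVariationOn w univ).toReal :=
          mul_le_mul_of_nonneg_left (hle _ _ (by linarith)) hz
  refine le_of_tendsto (intervalIntegral_tendsto_integral hdiff Filter.tendsto_neg_atTop_atBot
    Filter.tendsto_id) ?_
  filter_upwards [Filter.eventually_ge_atTop 0] with R hR using hbound R hR

lemma integral_abs_translate_sub_le {w : ℝ → ℝ} (hw : Integrable w)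
    (hbv : BoundedVariationOn w univ) (z : ℝ) :
    ∫ x, |w (x + z) - w x| ≤ |z| * (eVariationOn w univ).toReal := by
  rcases le_total 0 z with hz | hz
  · rw [abs_of_nonneg hz]
    exact integral_abs_translate_sub_le_of_nonneg hw hbv hz
  · rw [abs_of_nonpos hz, ← integral_sub_right_eq_self _ z]
    have := integral_abs_translate_sub_le_of_nonneg hw hbv (neg_nonneg.2 hz)
    simp only [← sub_eq_add_neg] at this
    simpa only [sub_add_cancel, abs_sub_comm] using this

/-- The symmetric second difference of the correlation of a function of bounded variation with
a bounded Lipschitz function is quadratically small. -/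
lemma abs_correlation_second_difference_le {w φ : ℝ → ℝ} {N : ℝ} (hN : 0 ≤ N)
    (hw : Integrable w) (hbv : BoundedVariationOn w univ)
    (hlip : LipschitzWith (Real.toNNReal N) φ) (hφ : ∀ x, |φ x| ≤ N) (z : ℝ) :
    |(∫ x, w (x - z) * φ x) + (∫ x, w (x + z) * φ x) - 2 * ∫ x, w x * φ x| ≤
      N * z ^ 2 * (eVariationOn w univ).toReal := by
  have hmul : ∀ a b : ℝ, Integrable fun x => w (x + a) * φ (x + b) := fun a b =>
    (hw.comp_add_right a).mul_bdd (c := N)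
      (hlip.continuous.comp (continuous_add_const b)).aestronglyMeasurable
      (.of_forall fun x => hφ _)
  have h00 : Integrable fun x => w x * φ x := by simpa using hmul 0 0
  have h0z : Integrable fun x => w x * φ (x + z) := by simpa using hmul 0 z
  have hz0 : Integrable fun x => w (x + z) * φ x := by simpa using hmul z 0
  have e1 : ∫ x, w (x - z) * φ x = ∫ x, w x * φ (x + z) := by
    rw [← integral_add_right_eq_self _ z]; simp
  have e2 : ∫ x, w x * φ x = ∫ x, w (x + z) * φ (x + z) :=
    (integral_add_right_eq_self (fun x => w x * φ x) z).symm
  have key : (∫ x, w (x - z) * φ x) + (∫ x, w (x + z) * φ x) - 2 * ∫ x, w x * φ x =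
      ∫ x, (w (x + z) - w x) * (φ x - φ (x + z)) := by
    have : (fun x => (w (x + z) - w x) * (φ x - φ (x + z))) = fun x =>
        (w x * φ (x + z) + w (x + z) * φ x) - (w x * φ x + w (x + z) * φ (x + z)) := by
      ext x; ring
    rw [this, integral_sub (f := fun x => w x * φ (x + z) + w (x + z) * φ x)
      (g := fun x => w x * φ x + w (x + z) * φ (x + z)) (h0z.add hz0) (h00.add (hmul z z)),
      integral_add h0z hz0,
      integral_add h00 (hmul z z), ← e1, ← e2]
    ring
  rw [key]
  calc |∫ x, (w (x + z) - w x) * (φ x - φ (x + z))|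
      ≤ ∫ x, |w (x + z) - w x| * (N * |z|) := by
        refine norm_integral_le_of_norm_le (f := fun x => (w (x + z) - w x) * (φ x - φ (x + z)))
          (((hw.comp_add_right z).sub hw).abs.mul_const _) (.of_forall fun x => ?_)
        rw [Real.norm_eq_abs, abs_mul]
        refine mul_le_mul_of_nonneg_left ?_ (abs_nonneg _)
        have := hlip.dist_le_mul x (x + z)
        simpa [Real.dist_eq, Real.coe_toNNReal _ hN] using this
    _ ≤ |z| * (eVariationOn w univ).toReal * (N * |z|) := by
        rw [integral_mul_const]
        exact mul_le_mul_of_nonneg_right (integral_abs_translate_sub_le hw hbv z) (by positivity)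
    _ = N * z ^ 2 * (eVariationOn w univ).toReal := by
        rw [← sq_abs z]; ring

/-- Mollification by an even probability density supported in `[-δ, δ]` changes a function of
bounded variation, tested against a bounded Lipschitz function, by `O(δ²)`. -/
lemma abs_integral_mollify_sub_mul_le {k w φ : ℝ → ℝ} {δ N : ℝ} (hk : ∀ z, 0 ≤ k z)
    (hk0 : ∀ z, δ ≤ |z| → k z = 0) (hkeven : ∀ z, k (-z) = k z) (hkint : ∫ z, k z = 1)
    (hN : 0 ≤ N) (hw : Integrable w) (hbv : BoundedVariationOn w univ)
    (hlip : LipschitzWith (Real.toNNReal N) φ) (hφ : ∀ x, |φ x| ≤ N) :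
    |∫ x, ((∫ y, k (x - y) * w y) - w x) * φ x| ≤
      1 / 2 * δ ^ 2 * N * (eVariationOn w univ).toReal := by
  have hkI : Integrable k := integrable_of_integral_eq_one hkint
  set A : ℝ → ℝ := fun z => ∫ x, w (x - z) * φ x with hA
  have hF : Integrable (fun p : ℝ × ℝ => k p.2 * w (p.1 - p.2) * φ p.1)
      (volume.prod volume) :=
    (hkI.convolution_integrand (ContinuousLinearMap.mul ℝ ℝ) hw).mul_bdd (c := N)
      (hlip.continuous.comp continuous_fst).aestronglyMeasurable (.of_forall fun p => hφ _)
  have hkA : Integrable fun z => k z * A z := by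
    simpa only [hA, mul_assoc, integral_const_mul] using hF.integral_prod_right
  have hwφ : Integrable fun x => w x * φ x :=
    hw.mul_bdd (c := N) hlip.continuous.aestronglyMeasurable (.of_forall fun x => hφ _)
  have hconv : ∀ x, ∫ y, k (x - y) * w y = ∫ z, k z * w (x - z) := fun x => by
    rw [← integral_sub_left_eq_self _ volume x]; simp
  have hI : ∫ x, ((∫ y, k (x - y) * w y) - w x) * φ x = (∫ z, k z * A z) - A 0 := by
    have h1 : Integrable fun x => (∫ z, k z * w (x - z)) * φ x := by
      simpa only [integral_mul_const] using hF.integral_prod_left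
    simp only [hconv, sub_mul]
    rw [integral_sub h1 hwφ]
    congr 1
    · simp only [hA, ← integral_mul_const, ← integral_const_mul, ← mul_assoc]
      exact integral_integral_swap hF
    · simp [hA]
  have hkA' : Integrable fun z => k z * A (-z) := by
    simpa only [hkeven] using hkA.comp_neg
  have hsymm : ∫ z, k z * A (-z) = ∫ z, k z * A z := by
    rw [← integral_neg_eq_self (fun z => k z * A z)]; simp only [hkeven]
  have h2 : 2 * ((∫ z, k z * A z) - A 0) = ∫ z, k z * (A z + A (-z) - 2 * A 0) := by
    simp only [mul_sub, mul_add]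
    rw [integral_sub (f := fun z => k z * A z + k z * A (-z)) (hkA.add hkA')
      (hkI.mul_const _), integral_add hkA hkA', hsymm,
      integral_mul_const, hkint]
    ring
  have h3 : |∫ z, k z * (A z + A (-z) - 2 * A 0)| ≤
      ∫ z, k z * (N * δ ^ 2 * (eVariationOn w univ).toReal) := by
    refine norm_integral_le_of_norm_le (f := fun z => k z * (A z + A (-z) - 2 * A 0))
      (hkI.mul_const _) (.of_forall fun z => ?_)
    rw [Real.norm_eq_abs, abs_mul, abs_of_nonneg (hk z)]
    rcases le_or_gt δ |z| with hz | hz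
    · simp [hk0 z hz]
    · refine mul_le_mul_of_nonneg_left ?_ (hk z)
      have := abs_correlation_second_difference_le hN hw hbv hlip hφ z
      simp only [hA, sub_neg_eq_add, sub_zero]
      refine this.trans ?_
      have hz2 : z ^ 2 ≤ δ ^ 2 := by
        rw [← sq_abs z]; exact pow_le_pow_left₀ (abs_nonneg z) hz.le 2
      gcongr
  rw [integral_mul_const, hkint, ← h2, abs_mul, abs_two] at h3
  rw [hI]
  linarith

/-- Lemma 6.2: for a smoothing kernel `K` and `K_δ(x) = δ⁻¹ K(x/δ)`,
there is a constant `C`, depending only on `K`, such that for every integrable BV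
function `w` and every Lipschitz compactly supported `φ`,
`|∫ (K_δ * w − w) φ| ≤ C δ² max{‖φ‖_∞, ‖φ'‖_∞} · Tot.Var.{w}`. -/
theorem stmt13 (K : ℝ → ℝ) (hK : ContDiff ℝ (⊤ : ℕ∞) K)
    (hKpos : ∀ x : ℝ, |x| < 1 → 0 < K x)
    (hK0 : ∀ x : ℝ, 1 ≤ |x| → K x = 0)
    (hKeven : ∀ x : ℝ, K (-x) = K x)
    (hKint : ∫ x : ℝ, K x = 1) :
    ∃ C : ℝ, ∀ (δ : ℝ), 0 < δ →
      ∀ (w : ℝ → ℝ), Integrable w → BoundedVariationOn w Set.univ →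
      ∀ (φ : ℝ → ℝ) (N : ℝ), HasCompactSupport φ →
        LipschitzWith (Real.toNNReal N) φ → (∀ x, |φ x| ≤ N) →
      |∫ x, ((∫ y, δ⁻¹ * K ((x - y) / δ) * w y) - w x) * φ x| ≤
        C * δ ^ 2 * N * (eVariationOn w Set.univ).toReal := by
  refine ⟨1 / 2, fun δ hδ w hw hbv φ N _ hlip hφ => ?_⟩
  have hK_nonneg : ∀ x, 0 ≤ K x := fun x =>
    (lt_or_ge |x| 1).elim (fun h => (hKpos x h).le) fun h => (hK0 x h).ge
  refine abs_integral_mollify_sub_mul_le (k := fun z => δ⁻¹ * K (z / δ))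
    (fun z => mul_nonneg (inv_nonneg.2 hδ.le) (hK_nonneg _)) (fun z hz => ?_) (fun z => ?_) ?_
    ((abs_nonneg _).trans (hφ 0)) hw hbv hlip hφ
  · have : 1 ≤ |z / δ| := by rwa [abs_div, abs_of_pos hδ, one_le_div hδ]
    simp [hK0 _ this]
  · simp only [neg_div, hKeven]
  · rw [integral_const_mul, Measure.integral_comp_div, hKint, abs_of_pos hδ]
    simp [hδ.ne']
end

section
/- Let K be a smoothing kernel and, for δ > 0, let K_δ(x) = δ^{−1} K(x/δ). Then there exists a constant C, depending only on K, such that for every Lipschitz continuous compactly supported φ : ℝ → ℝ and every x ∈ ℝ, | ∫_{−∞}^x ∫_ℝ K_δ(z − y) ( φ(y) − φ(z) ) dy dz | ≤ C δ² · max{‖φ‖_{L∞}, ‖φ'‖_{L∞}}. -/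
open Set MeasureTheory

lemma setIntegral_Iic_sub_translate {φ : ℝ → ℝ} (hφ : Integrable φ) (x h : ℝ) :
    ∫ z in Iic x, (φ (z - h) - φ z) = -∫ z in (x - h)..x, φ z := by
  rw [integral_sub (hφ.comp_sub_right h).integrableOn hφ.integrableOn,
    ← intervalIntegral.integral_Iic_sub_Iic hφ.integrableOn hφ.integrableOn]
  have key := (measurePreserving_sub_right volume h).setIntegral_preimage_emb
    (MeasurableEquiv.subRight h).measurableEmbedding φ (Iic (x - h))
  have hpre : (fun z : ℝ => z - h) ⁻¹' Iic (x - h) = Iic x := by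
    ext z
    simp
  rw [hpre] at key
  rw [key]
  ring

lemma abs_mul_sub_integral_le {φ : ℝ → ℝ} {N : ℝ} (hN : 0 ≤ N)
    (hφ : LipschitzWith (Real.toNNReal N) φ) (x h : ℝ) :
    |h * φ x - ∫ z in (x - h)..x, φ z| ≤ N * h ^ 2 := by
  have hrep : h * φ x - ∫ z in (x - h)..x, φ z = ∫ z in (x - h)..x, (φ x - φ z) := by
    rw [intervalIntegral.integral_sub intervalIntegrable_const
      (hφ.continuous.intervalIntegrable _ _)]
    simp
  rw [hrep, ← Real.norm_eq_abs]
  have hbound : ∀ z ∈ uIoc (x - h) x, ‖φ x - φ z‖ ≤ N * |h| := by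
    intro z hz
    have hzx : |x - z| ≤ |h| := by
      have := abs_sub_right_of_mem_uIcc (uIoc_subset_uIcc hz)
      simpa using this
    have hdist := hφ.dist_le_mul x z
    rw [Real.dist_eq, Real.dist_eq, Real.coe_toNNReal N hN] at hdist
    exact hdist.trans (mul_le_mul_of_nonneg_left hzx hN)
  refine (intervalIntegral.norm_integral_le_of_norm_le_const hbound).trans_eq ?_
  rw [sub_sub_cancel, mul_assoc, abs_mul_abs_self, sq]

lemma setIntegral_Iic_integral_kernel_sub {k φ : ℝ → ℝ} (hk : Integrable k) (hφ : Integrable φ)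
    (x : ℝ) :
    ∫ z in Iic x, ∫ y, k (z - y) * (φ y - φ z) = ∫ w, k w * -∫ z in (x - w)..x, φ z := by
  have hsubst : ∀ z, ∫ y, k (z - y) * (φ y - φ z) = ∫ w, k w * (φ (z - w) - φ z) := by
    intro z
    rw [← integral_sub_left_eq_self _ volume z]
    simp
  have hint : Integrable (fun p : ℝ × ℝ => k p.2 * (φ (p.1 - p.2) - φ p.1))
      ((volume.restrict (Iic x)).prod volume) := by
    have h₁ : Integrable (fun p : ℝ × ℝ => k p.2 * φ (p.1 - p.2)) (volume.prod volume) :=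
      hk.convolution_integrand (ContinuousLinearMap.mul ℝ ℝ) hφ
    have h₂ : Integrable (fun p : ℝ × ℝ => φ p.1 * k p.2) (volume.prod volume) :=
      hφ.mul_prod hk
    have h₃ := (h₁.sub h₂).restrict (s := Iic x ×ˢ univ)
    rw [← Measure.prod_restrict, Measure.restrict_univ] at h₃
    refine h₃.congr (Filter.Eventually.of_forall fun p => ?_)
    simp only [Pi.sub_apply]
    ring
  simp_rw [hsubst]
  rw [integral_integral_swap hint]
  simp_rw [integral_const_mul, setIntegral_Iic_sub_translate hφ]

lemma integral_mul_id_eq_zero_of_even {k : ℝ → ℝ} (hk : ∀ w, k (-w) = k w) :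
    ∫ w, k w * w = 0 := by
  have h := integral_neg_eq_self (fun w => k w * w) volume
  simp only [hk, mul_neg, integral_neg] at h
  linarith

/-- Second-order estimate for an even probability density `k` supported in `[-δ, δ]`. -/
lemma abs_setIntegral_Iic_integral_kernel_sub_le {k φ : ℝ → ℝ} {δ N : ℝ}
    (hk : Continuous k) (hk_nonneg : ∀ w, 0 ≤ k w) (hk_supp : ∀ w, δ ≤ |w| → k w = 0)
    (hk_even : ∀ w, k (-w) = k w) (hk_int : ∫ w, k w = 1) (hN : 0 ≤ N)
    (hφ_supp : HasCompactSupport φ) (hφ : LipschitzWith (Real.toNNReal N) φ) (x : ℝ) :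
    |∫ z in Iic x, ∫ y, k (z - y) * (φ y - φ z)| ≤ δ ^ 2 * N := by
  have hk_compact : HasCompactSupport k := by
    refine HasCompactSupport.intro (isCompact_Icc (a := -δ) (b := δ)) fun w hw => hk_supp w ?_
    by_contra! h
    exact hw (abs_le.mp h.le)
  have hki : Integrable k := hk.integrable_of_hasCompactSupport hk_compact
  have hφi : Integrable φ := hφ.continuous.integrable_of_hasCompactSupport hφ_supp
  have hprim : Continuous fun w => ∫ z in (x - w)..x, φ z := by
    have h := intervalIntegral.continuous_primitive
      (fun a b => hφ.continuous.intervalIntegrable (μ := volume) a b) x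
    simp_rw [fun w => intervalIntegral.integral_symm (μ := volume) (f := φ) x (x - w)]
    exact (h.comp (continuous_const.sub continuous_id)).neg
  have hi₁ : Integrable fun w => k w * -∫ z in (x - w)..x, φ z :=
    (hk.mul hprim.neg).integrable_of_hasCompactSupport hk_compact.mul_right
  have hi₂ : Integrable fun w => k w * w :=
    (hk.mul continuous_id).integrable_of_hasCompactSupport hk_compact.mul_right
  have hcenter : ∫ w, k w * -∫ z in (x - w)..x, φ z
      = ∫ w, k w * (w * φ x - ∫ z in (x - w)..x, φ z) := by
    have hsplit : ∀ w, k w * (w * φ x - ∫ z in (x - w)..x, φ z)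
        = k w * w * φ x + k w * -∫ z in (x - w)..x, φ z := fun w => by ring
    simp_rw [hsplit]
    rw [integral_add (hi₂.mul_const _) hi₁, integral_mul_const,
      integral_mul_id_eq_zero_of_even hk_even, zero_mul, zero_add]
  rw [setIntegral_Iic_integral_kernel_sub hki hφi, hcenter, ← Real.norm_eq_abs]
  have hbound : ∀ w, ‖k w * (w * φ x - ∫ z in (x - w)..x, φ z)‖ ≤ k w * (δ ^ 2 * N) := by
    intro w
    rw [norm_mul, Real.norm_of_nonneg (hk_nonneg w), Real.norm_eq_abs]
    rcases le_or_gt δ |w| with h | h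
    · simp [hk_supp w h]
    · refine mul_le_mul_of_nonneg_left ((abs_mul_sub_integral_le hN hφ x w).trans ?_)
        (hk_nonneg w)
      rw [mul_comm]
      exact mul_le_mul_of_nonneg_right (sq_le_sq.mpr (h.le.trans (le_abs_self δ))) hN
  refine (norm_integral_le_of_norm_le (hki.mul_const _)
    (Filter.Eventually.of_forall hbound)).trans_eq ?_
  rw [integral_mul_const, hk_int, one_mul]

/-- for a smoothing kernel `K` and `K_δ(x) = δ⁻¹ K(x/δ)`, there is a
constant `C`, depending only on `K`, such that for every Lipschitz compactly supported
`φ` and every `x`,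
`|∫_{−∞}^x ∫ K_δ(z−y)(φ(y)−φ(z)) dy dz| ≤ C δ² max{‖φ‖_∞, ‖φ'‖_∞}`. -/
theorem stmt14 (K : ℝ → ℝ) (hK : ContDiff ℝ (⊤ : ℕ∞) K)
    (hKpos : ∀ x : ℝ, |x| < 1 → 0 < K x)
    (hK0 : ∀ x : ℝ, 1 ≤ |x| → K x = 0)
    (hKeven : ∀ x : ℝ, K (-x) = K x)
    (hKint : ∫ x : ℝ, K x = 1) :
    ∃ C : ℝ, ∀ (δ : ℝ), 0 < δ →
      ∀ (φ : ℝ → ℝ) (N : ℝ), HasCompactSupport φ →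
        LipschitzWith (Real.toNNReal N) φ → (∀ x, |φ x| ≤ N) →
      ∀ x : ℝ,
      |∫ z in Set.Iic x, ∫ y, δ⁻¹ * K ((z - y) / δ) * (φ y - φ z)| ≤ C * δ ^ 2 * N := by
  refine ⟨1, fun δ hδ φ N hφ_supp hφ hN x => ?_⟩
  rw [one_mul]
  refine abs_setIntegral_Iic_integral_kernel_sub_le (k := fun w => δ⁻¹ * K (w / δ))
    ?_ (fun w => ?_) (fun w hw => ?_) (fun w => ?_) ?_ ((abs_nonneg _).trans (hN 0)) hφ_supp hφ x
  · exact continuous_const.mul (hK.continuous.comp (continuous_id.div_const δ))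
  · refine mul_nonneg (inv_nonneg.mpr hδ.le) ?_
    rcases lt_or_ge |w / δ| 1 with h | h
    · exact (hKpos _ h).le
    · exact (hK0 _ h).ge
  · rw [hK0, mul_zero]
    rwa [abs_div, abs_of_pos hδ, one_le_div hδ]
  · rw [neg_div, hKeven]
  · rw [integral_const_mul, Measure.integral_comp_div, hKint, abs_of_pos hδ, smul_eq_mul, mul_one,
      inv_mul_cancel₀ hδ.ne']
end

section
/- Let σ ≥ ε > 0, K > 0, and let u : ℝ → ℝⁿ be a function of bounded variation. Call a point x ∈ ℝ flagged if min{ Tot.Var.{u; [x − σ, x + ε]}, Tot.Var.{u; [x − ε, x + σ]} } > K σ. If a ≤ b and no point of the interval [a, b] is flagged, then | u(a) − u(b) | ≤ ( 1 + (b − a)/(σ + ε) ) · 2 σ K. -/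
open Set

theorem BoundedVariationOn.norm_sub_le_of_toReal_le {E : Type*} [SeminormedAddCommGroup E]
    {u : ℝ → E} (hu : BoundedVariationOn u Set.univ) {s : Set ℝ} {C : ℝ}
    (hC : (eVariationOn u s).toReal ≤ C) {p q : ℝ} (hp : p ∈ s) (hq : q ∈ s) :
    ‖u p - u q‖ ≤ C := by
  have h := (hu.mono (Set.subset_univ s)).dist_le hp hq
  rw [dist_eq_norm] at h
  exact h.trans hC

/-- If every point of `[a, b]` has a one-sided window, `[x - σ, x + ε]` or `[x - ε, x + σ]`,
on which `u` oscillates by at most `C`, and `b - a ≤ σ + ε`, then `u a` and `u b` differ by at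
most `2 * C`. -/
theorem norm_sub_le_two_mul_of_windows {E : Type*} [SeminormedAddCommGroup E]
    {σ ε C : ℝ} (hσε : ε ≤ σ) (hε : 0 < ε) {u : ℝ → E} {a b : ℝ} (hab : a ≤ b)
    (hlen : b ≤ a + (σ + ε))
    (h : ∀ x ∈ Set.Icc a b,
      (∀ p ∈ Set.Icc (x - σ) (x + ε), ∀ q ∈ Set.Icc (x - σ) (x + ε), ‖u p - u q‖ ≤ C) ∨
      (∀ p ∈ Set.Icc (x - ε) (x + σ), ∀ q ∈ Set.Icc (x - ε) (x + σ), ‖u p - u q‖ ≤ C)) :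
    ‖u a - u b‖ ≤ 2 * C := by
  have hC : 0 ≤ C := by
    rcases h a ⟨le_rfl, hab⟩ with h | h <;>
      exact (norm_nonneg _).trans
        (h a ⟨by linarith, by linarith⟩ a ⟨by linarith, by linarith⟩)
  have two_steps : ∀ m, ‖u a - u m‖ ≤ C → ‖u m - u b‖ ≤ C → ‖u a - u b‖ ≤ 2 * C := by
    intro m h₁ h₂
    linarith [norm_sub_le_norm_sub_add_norm_sub (u a) (u m) (u b)]
  have one_step : ‖u a - u b‖ ≤ C → ‖u a - u b‖ ≤ 2 * C := fun h => by linarith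
  obtain ⟨c, hac, hcb, hcσ, hc⟩ : ∃ c, a ≤ c ∧ c ≤ b ∧ c ≤ a + σ ∧ (c = b ∨ c = a + σ) := by
    rcases le_total b (a + σ) with hb | hb
    · exact ⟨b, hab, le_rfl, hb, Or.inl rfl⟩
    · exact ⟨a + σ, by linarith, hb, le_rfl, Or.inr rfl⟩
  have hcσb : b ≤ c + σ := by rcases hc with rfl | rfl <;> linarith
  have hcεb : b ≤ c + ε := by rcases hc with rfl | rfl <;> linarith
  rcases h c ⟨hac, hcb⟩ with hL | hR
  · exact one_step (hL a ⟨by linarith, by linarith⟩ b ⟨by linarith, hcεb⟩)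
  let S : Set ℝ := {x | x ∈ Set.Icc a c ∧
    ∀ p ∈ Set.Icc (x - σ) (x + ε), ∀ q ∈ Set.Icc (x - σ) (x + ε), ‖u p - u q‖ ≤ C}
  have hSbdd : BddAbove S := ⟨c, fun x hx => hx.1.2⟩
  rcases S.eq_empty_or_nonempty with hSe | hSne
  · have ha : a ∉ S := by simp [hSe]
    rcases h a ⟨le_rfl, hab⟩ with hL | hR'
    · exact absurd ⟨⟨le_rfl, hac⟩, hL⟩ ha
    · exact two_steps c (hR' a ⟨by linarith, by linarith⟩ c ⟨by linarith, hcσ⟩)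
        (hR c ⟨by linarith, by linarith⟩ b ⟨by linarith, hcσb⟩)
  · obtain ⟨x, hxS, hx⟩ := exists_lt_of_lt_csSup hSne (sub_lt_self (sSup S) hε)
    obtain ⟨⟨hax, hxc⟩, hxL⟩ := hxS
    rcases le_or_gt (x + ε) c with hy | hy
    · rcases h (x + ε) ⟨by linarith, by linarith⟩ with hL | hR'
      · have := le_csSup hSbdd (show x + ε ∈ S from ⟨⟨by linarith, hy⟩, hL⟩)
        linarith
      · exact two_steps (x + ε) (hxL a ⟨by linarith, by linarith⟩ _ ⟨by linarith, le_rfl⟩)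
          (hR' _ ⟨by linarith, by linarith⟩ b ⟨by linarith, by linarith⟩)
    · exact two_steps c (hxL a ⟨by linarith, by linarith⟩ c ⟨by linarith, hy.le⟩)
        (hR c ⟨by linarith, by linarith⟩ b ⟨by linarith, hcσb⟩)

/-- Lemma 7.1: if no point of `[a,b]` is flagged, i.e. for every
`x ∈ [a,b]` one has
`min{Tot.Var.{u; [x−σ, x+ε]}, Tot.Var.{u; [x−ε, x+σ]}} ≤ K σ`, then
`|u(a) − u(b)| ≤ (1 + (b−a)/(σ+ε)) · 2σK`. -/
theorem stmt17 {n : ℕ} (σ ε K : ℝ) (hσε : ε ≤ σ) (hε : 0 < ε) (hK : 0 < K)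
    (u : ℝ → EuclideanSpace ℝ (Fin n))
    (hBV : BoundedVariationOn u Set.univ)
    (a b : ℝ) (hab : a ≤ b)
    (hnoflag : ∀ x ∈ Set.Icc a b,
      ¬ (K * σ < min ((eVariationOn u (Set.Icc (x - σ) (x + ε))).toReal)
          ((eVariationOn u (Set.Icc (x - ε) (x + σ))).toReal))) :
    ‖u a - u b‖ ≤ (1 + (b - a) / (σ + ε)) * (2 * σ * K) := by
  have hσ : 0 < σ := hε.trans_le hσε
  have hl : 0 < σ + ε := by linarith
  have hwin : ∀ x ∈ Set.Icc a b,
      (∀ p ∈ Set.Icc (x - σ) (x + ε), ∀ q ∈ Set.Icc (x - σ) (x + ε), ‖u p - u q‖ ≤ K * σ) ∨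
      (∀ p ∈ Set.Icc (x - ε) (x + σ), ∀ q ∈ Set.Icc (x - ε) (x + σ), ‖u p - u q‖ ≤ K * σ) := by
    intro x hx
    rcases min_le_iff.mp (not_lt.mp (hnoflag x hx)) with h | h
    · exact Or.inl fun p hp q hq => hBV.norm_sub_le_of_toReal_le h hp hq
    · exact Or.inr fun p hp q hq => hBV.norm_sub_le_of_toReal_le h hp hq
  have hlocal : ∀ c d, a ≤ c → c ≤ d → d ≤ b → d ≤ c + (σ + ε) →
      ‖u c - u d‖ ≤ 2 * (K * σ) := fun c d hac hcd hdb hlen =>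
    norm_sub_le_two_mul_of_windows hσε hε hcd hlen
      fun x hx => hwin x ⟨hac.trans hx.1, hx.2.trans hdb⟩
  have hsteps : ∀ (N : ℕ) (d : ℝ), a ≤ d → d ≤ b → d ≤ a + (N + 1) * (σ + ε) →
      ‖u a - u d‖ ≤ (N + 1) * (2 * (K * σ)) := by
    intro N
    induction N with
    | zero =>
      intro d had hdb hd
      simpa using hlocal a d le_rfl had hdb (by simpa using hd)
    | succ N ih =>
      intro d had hdb hd
      push_cast at hd ⊢
      have hmd : max a (d - (σ + ε)) ≤ d := max_le had (by linarith)
      have h₁ := ih (max a (d - (σ + ε))) (le_max_left _ _) (hmd.trans hdb)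
        (max_le (by linarith [show 0 ≤ ((N : ℝ) + 1) * (σ + ε) by positivity]) (by linarith))
      have h₂ := hlocal (max a (d - (σ + ε))) d (le_max_left _ _) hmd hdb
        (by linarith [le_max_right a (d - (σ + ε))])
      linarith [norm_sub_le_norm_sub_add_norm_sub (u a) (u (max a (d - (σ + ε)))) (u d)]
  have hfloor := (div_lt_iff₀ hl).mp (Nat.lt_floor_add_one ((b - a) / (σ + ε)))
  have hle := Nat.floor_le (div_nonneg (sub_nonneg.mpr hab) hl.le)
  calc ‖u a - u b‖ ≤ (⌊(b - a) / (σ + ε)⌋₊ + 1) * (2 * (K * σ)) :=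
        hsteps _ b hab le_rfl (by linarith)
    _ ≤ (1 + (b - a) / (σ + ε)) * (2 * (K * σ)) :=
        mul_le_mul_of_nonneg_right (by linarith) (by positivity)
    _ = (1 + (b - a) / (σ + ε)) * (2 * σ * K) := by ring
end

section
/- Let σ ≥ ε > 0 and let [a, b] = I⁺ ∪ I⁻, where I⁺ and I⁻ are disjoint sets. For x ∈ I⁺ set J_x = [x − ε, x + σ], and for x ∈ I⁻ set J_x = [x − σ, x + ε]. Then every subinterval [c, d] ⊆ [a, b] with d − c ≤ σ + ε is covered by at most two of the intervals J_x: there exist points x, y ∈ [a, b] such that [c, d] ⊆ J_x ∪ J_y. -/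
open Set
open scoped Classical

/-- if `[a,b] = I⁺ ∪ I⁻` with `I⁺, I⁻` disjoint, `J_x = [x−ε, x+σ]` for
`x ∈ I⁺` and `J_x = [x−σ, x+ε]` otherwise, then every subinterval `[c,d] ⊆ [a,b]` with
`d − c ≤ σ + ε` is covered by two of the intervals `J_x`, `x ∈ [a,b]`. -/
theorem stmt18 (σ ε a b : ℝ) (hσε : ε ≤ σ) (hε : 0 < ε)
    (Ip Im : Set ℝ) (hdisj : Disjoint Ip Im) (hunion : Ip ∪ Im = Set.Icc a b)
    (c d : ℝ) (hcd : c ≤ d) (hsub : Set.Icc c d ⊆ Set.Icc a b)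
    (hlen : d - c ≤ σ + ε) :
    ∃ x ∈ Set.Icc a b, ∃ y ∈ Set.Icc a b,
      Set.Icc c d ⊆
        (if x ∈ Ip then Set.Icc (x - ε) (x + σ) else Set.Icc (x - σ) (x + ε)) ∪
        (if y ∈ Ip then Set.Icc (y - ε) (y + σ) else Set.Icc (y - σ) (y + ε)) := by
  have hIm : ∀ z ∈ Set.Icc c d, z ∉ Ip → z ∈ Im := fun z hz hzp =>
    (hunion.symm ▸ hsub hz : z ∈ Ip ∪ Im).resolve_left hzp
  have hc : c ∈ Set.Icc c d := ⟨le_rfl, hcd⟩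
  have hd : d ∈ Set.Icc c d := ⟨hcd, le_rfl⟩
  by_cases hcp : c ∈ Ip
  · refine ⟨c, hsub hc, d, hsub hd, fun t ht => ?_⟩
    rcases le_total t (c + σ) with h | h
    · left
      rw [if_pos hcp]
      constructor <;> linarith [ht.1]
    · right
      split_ifs <;> constructor <;> linarith [ht.2]
  rcases lt_or_ge (d - ε) c with hshort | hlong
  · refine ⟨c, hsub hc, c, hsub hc, fun t ht => ?_⟩
    left
    rw [if_neg hcp]
    constructor <;> linarith [ht.1, ht.2]
  have hne : (Im ∩ Set.Icc c (d - ε)).Nonempty := ⟨c, hIm c hc hcp, le_rfl, hlong⟩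
  have hbdd : BddAbove (Im ∩ Set.Icc c (d - ε)) := ⟨d - ε, fun z hz => hz.2.2⟩
  obtain ⟨p, ⟨hpm, hpc, hpd⟩, hp⟩ := exists_lt_of_lt_csSup hne (sub_lt_self _ hε)
  have hpp : p ∉ Ip := fun h => Set.disjoint_left.mp hdisj h hpm
  have hq : p + ε ∈ Set.Icc c d := ⟨by linarith, by linarith⟩
  by_cases hqp : p + ε ∈ Ip
  · refine ⟨p, hsub ⟨hpc, by linarith⟩, p + ε, hsub hq, fun t ht => ?_⟩
    rw [if_neg hpp, if_pos hqp]
    rcases le_total t (p + ε) with h | h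
    · left
      constructor <;> linarith [ht.1]
    · right
      constructor <;> linarith [ht.2]
  · have hqd : d - ε < p + ε := by
      by_contra! h
      linarith [le_csSup hbdd ⟨hIm _ hq hqp, hq.1, h⟩]
    refine ⟨c, hsub hc, p + ε, hsub hq, fun t ht => ?_⟩
    rw [if_neg hcp, if_neg hqp]
    rcases le_total t (c + ε) with h | h
    · left
      constructor <;> linarith [ht.1]
    · right
      constructor <;> linarith [ht.2]
end
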